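/- arXiv:1708.05330 — 3 statements merged into one kernel-verified Lean document; each statement's English description precedes it below -/
import Mathlib

section
/- Let T be a ternary operation on a set X, let T̂ be defined by xyzT̂ = zyxT, and let y^r denote the reversal of a tuple (extended linearly to chains). Then for every n ≥ 1 and every (n+2)-tuple x of elements of X: ∂_n^{R,T}(x) = (-1)^n (∂_n^{L,T̂}(x^r))^r, where ∂_n^{L} = Σ_{i=0}^n (-1)^i d_i^{n,L} and ∂_n^{R} = Σ_{i=0}^n (-1)^i d_i^{n,R} in the free abelian group on (n+1)-tuples. -/
variable {X : Type*}

/-- The reversed operation `T̂`, with `xyzT̂ = zyxT`. -/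
def hatOp (S : X → X → X → X) : X → X → X → X := fun x y z => S z y x

/-- Extend an `(n+2)`-tuple `x = (x_0, …, x_{n+1})` to a function on `ℕ`
(values beyond index `n+1` are irrelevant junk). -/
def ext (n : ℕ) (x : Fin (n + 2) → X) : ℕ → X :=
  fun m => if h : m < n + 2 then x ⟨m, h⟩ else x 0

/-- Coordinate description of the left face maps: `d_{i,k}^{L}` is `x_k` for
`k > i` and `x_{k-1}x_k(d_{i,k+1}^{L}x)T` for `k ≤ i` (computed right to left). -/
def dLcoord (T : X → X → X → X) (i : ℕ) (x : ℕ → X) (k : ℕ) : X :=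
  if h : i < k then x k
  else T (x (k - 1)) (x k) (dLcoord T i x (k + 1))
termination_by i + 1 - k
decreasing_by omega

/-- Coordinate description of the right face maps: `d_{i,k}^{R}` is `x_k` for
`k ≤ i` and `(d_{i,k-1}^{R}x)x_kx_{k+1}T` for `k > i` (computed left to right). -/
def dRcoord (T : X → X → X → X) (i : ℕ) (x : ℕ → X) (k : ℕ) : X :=
  if h : k ≤ i then x k
  else T (dRcoord T i x (k - 1)) (x k) (x (k + 1))
termination_by k
decreasing_by omega

/-- Inductive description of the left face maps:
`d_0^{L}x = (x_1, …, x_{n+1})` and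
`d_i^{L}x = d_{i-1}^{L}(x  with  x_i ↦ x_{i-1}x_ix_{i+1}T)`.
The result is indexed so that entry `k` is the `(k+1)`-st coordinate. -/
def dLind (T : X → X → X → X) : ℕ → (ℕ → X) → ℕ → X
  | 0, x, k => x (k + 1)
  | i + 1, x, k =>
      dLind T i (fun m => if m = i + 1 then T (x i) (x (i + 1)) (x (i + 2)) else x m) k

/-- The left face map `d_i^{n,L}` (coordinate description), as a map from
`(n+2)`-tuples to `(n+1)`-tuples; entry `p` is the coordinate `d_{i,p+1}^{n,L}`. -/
def dL (T : X → X → X → X) (n i : ℕ) (x : Fin (n + 2) → X) : Fin (n + 1) → X :=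
  fun p => dLcoord T i (ext n x) (p.1 + 1)

/-- The left face map `d_i^{n,L}` (inductive description). -/
def dLInd (T : X → X → X → X) (n i : ℕ) (x : Fin (n + 2) → X) : Fin (n + 1) → X :=
  fun p => dLind T i (ext n x) p.1

/-- The right face map `d_i^{n,R}`; entry `p` is the coordinate `d_{i,p}^{n,R}`. -/
def dR (T : X → X → X → X) (n i : ℕ) (x : Fin (n + 2) → X) : Fin (n + 1) → X :=
  fun p => dRcoord T i (ext n x) p.1

/-- The boundary homomorphism `∂_{n}^{L} = Σ_{i=0}^{n} (-1)^i d_i^{n,L}`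
on the free abelian group on `(n+2)`-tuples (used for `n ≥ 1`). -/
def boundaryL (T : X → X → X → X) (n : ℕ) :
    FreeAbelianGroup (Fin (n + 2) → X) →+ FreeAbelianGroup (Fin (n + 1) → X) :=
  FreeAbelianGroup.lift fun x =>
    ∑ i ∈ Finset.range (n + 1), ((-1 : ℤ) ^ i) • FreeAbelianGroup.of (dL T n i x)

/-- The boundary homomorphism `∂_{n}^{R} = Σ_{i=0}^{n} (-1)^i d_i^{n,R}`. -/
def boundaryR (T : X → X → X → X) (n : ℕ) :
    FreeAbelianGroup (Fin (n + 2) → X) →+ FreeAbelianGroup (Fin (n + 1) → X) :=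
  FreeAbelianGroup.lift fun x =>
    ∑ i ∈ Finset.range (n + 1), ((-1 : ℤ) ^ i) • FreeAbelianGroup.of (dR T n i x)

/-- The boundary homomorphism `∂_n = ∂_n^L - ∂_n^R`. -/
def boundary (T : X → X → X → X) (n : ℕ) :
    FreeAbelianGroup (Fin (n + 2) → X) →+ FreeAbelianGroup (Fin (n + 1) → X) :=
  boundaryL T n - boundaryR T n

/-- An `(m+2)`-tuple is degenerate if it contains, on three consecutive
coordinates, a triple `(a, b, abbR)` (condition D1) or `(bbaL, b, a)`
(condition D2). -/
def IsDegenerate (L R : X → X → X → X) (m : ℕ) (x : Fin (m + 2) → X) : Prop :=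
  ∃ (j : ℕ) (h : j + 2 < m + 2) (a b : X),
    (x ⟨j, by omega⟩ = a ∧ x ⟨j + 1, by omega⟩ = b ∧ x ⟨j + 2, h⟩ = R a b b) ∨
    (x ⟨j, by omega⟩ = L b b a ∧ x ⟨j + 1, by omega⟩ = b ∧ x ⟨j + 2, h⟩ = a)

/-- `C_m^D(X)`: the subgroup of `C_m(X)` generated by the degenerate tuples. -/
def CD (L R : X → X → X → X) (m : ℕ) :
    AddSubgroup (FreeAbelianGroup (Fin (m + 2) → X)) :=
  AddSubgroup.closure {c | ∃ x, IsDegenerate L R m x ∧ c = FreeAbelianGroup.of x}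

/-- `x[j]`: the tuple obtained from `x` by replacing `x_j` with `x_{j-1}x_jx_{j+1}T`. -/
def tupleSub (T : X → X → X → X) (m : ℕ) (x : Fin (m + 2) → X) (j : ℕ)
    (h1 : 1 ≤ j) (h2 : j ≤ m) : Fin (m + 2) → X :=
  Function.update x ⟨j, by omega⟩
    (T (x ⟨j - 1, by omega⟩) (x ⟨j, by omega⟩) (x ⟨j + 1, by omega⟩))

/-- `C_m^I(X)`: the subgroup of `C_m(X)` generated by the sums `x + x[j]`,
`1 ≤ j ≤ m`. -/
def CI (T : X → X → X → X) (m : ℕ) :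
    AddSubgroup (FreeAbelianGroup (Fin (m + 2) → X)) :=
  AddSubgroup.closure {c | ∃ (x : Fin (m + 2) → X) (j : ℕ) (h1 : 1 ≤ j) (h2 : j ≤ m),
    c = FreeAbelianGroup.of x + FreeAbelianGroup.of (tupleSub T m x j h1 h2)}

/-- `C_m^{ID}(X)`: the subgroup of `C_m(X)` generated by the sums `x + x[j]`
together with the degenerate tuples. -/
def CID (T L R : X → X → X → X) (m : ℕ) :
    AddSubgroup (FreeAbelianGroup (Fin (m + 2) → X)) :=
  AddSubgroup.closure
    ({c | ∃ (x : Fin (m + 2) → X) (j : ℕ) (h1 : 1 ≤ j) (h2 : j ≤ m),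
        c = FreeAbelianGroup.of x + FreeAbelianGroup.of (tupleSub T m x j h1 h2)} ∪
      {c | ∃ x, IsDegenerate L R m x ∧ c = FreeAbelianGroup.of x})

/-- Reversal of a tuple. -/
def revTuple {m : ℕ} (x : Fin m → X) : Fin m → X := fun k => x k.rev

theorem ext_revTuple (n : ℕ) (x : Fin (n + 2) → X) {m : ℕ} (hm : m ≤ n + 1) :
    ext n (revTuple x) m = ext n x (n + 1 - m) := by
  have h₁ : m < n + 2 := by omega
  have h₂ : n + 1 - m < n + 2 := by omega
  simp only [ext, revTuple, h₁, h₂, dif_pos]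
  congr 1
  ext
  simp only [Fin.val_rev]
  omega

/-- Reversing the coordinates exchanges the right face coordinates of `T` with the left face
coordinates of `T̂`. -/
theorem dRcoord_eq_dLcoord_hatOp (T : X → X → X → X) (n : ℕ) (x y : ℕ → X)
    (hxy : ∀ m ≤ n + 1, y m = x (n + 1 - m)) {i : ℕ} (hi : i ≤ n) {k : ℕ} (hk : k ≤ n) :
    dRcoord T i x k = dLcoord (hatOp T) (n - i) y (n + 1 - k) := by
  induction k with
  | zero =>
    rw [dRcoord, dLcoord, dif_pos (Nat.zero_le i), dif_pos (by omega), hxy _ (by omega)]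
    congr 1
    omega
  | succ k ih =>
    rw [dRcoord, dLcoord]
    by_cases h : k + 1 ≤ i
    · rw [dif_pos h, dif_pos (by omega), hxy _ (by omega)]
      congr 1
      omega
    · rw [dif_neg h, dif_neg (by omega), Nat.add_sub_cancel, ih (by omega),
        hxy _ (by omega), hxy _ (by omega), hatOp]
      congr 2 <;> omega

theorem dR_eq_revTuple_dL_hatOp (T : X → X → X → X) {n i : ℕ} (hi : i ≤ n)
    (x : Fin (n + 2) → X) :
    dR T n i x = revTuple (dL (hatOp T) n (n - i) (revTuple x)) := by
  funext p
  have hp : n + 1 - p.1 = p.rev.1 + 1 := by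
    rw [Fin.val_rev]
    omega
  rw [dR, revTuple, dL, ← hp]
  exact dRcoord_eq_dLcoord_hatOp T n _ _ (fun m hm => ext_revTuple n x hm) hi (by omega)

/-- `∂_n^{R,T}(x) = (-1)^n (∂_n^{L,T̂}(x^r))^r` for every `n ≥ 1`
and every `(n+2)`-tuple `x`, where reversal is extended linearly to chains. -/
theorem boundaryR_eq_rev_boundaryL_hat {X : Type*} (T : X → X → X → X)
    (n : ℕ) (hn : 1 ≤ n) (x : Fin (n + 2) → X) :
    boundaryR T n (FreeAbelianGroup.of x) =
      ((-1 : ℤ) ^ n) •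
        FreeAbelianGroup.map (revTuple : (Fin (n + 1) → X) → (Fin (n + 1) → X))
          (boundaryL (hatOp T) n (FreeAbelianGroup.of (revTuple x))) := by
  simp only [boundaryR, boundaryL, FreeAbelianGroup.lift_apply_of, map_sum, map_zsmul,
    FreeAbelianGroup.map_of_apply, Finset.smul_sum, smul_smul]
  rw [← Finset.sum_range_reflect]
  refine Finset.sum_congr rfl fun j hj => ?_
  have hj' : j ≤ n := Nat.lt_succ_iff.mp (Finset.mem_range.mp hj)
  have hsub : n + 1 - 1 - j = n - j := by omega
  have hsign : (-1 : ℤ) ^ (n - j) = (-1) ^ n * (-1) ^ j := by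
    rw [← pow_add, show n + j = n - j + 2 * j by omega, pow_add, pow_mul]
    simp
  rw [hsub, dR_eq_revTuple_dL_hatOp T (Nat.sub_le n j) x, Nat.sub_sub_self hj', hsign]
end

section
/- For a knot-theoretic ternary quasigroup (KTQ) X and every n: ∂_n^R(C_n^D(X)) ⊆ C_{n-1}^D(X). -/
variable {X : Type*}

theorem ext_of_lt {X : Type*} (n : ℕ) (x : Fin (n + 2) → X) {k : ℕ} (h : k < n + 2) :
    ext n x k = x ⟨k, h⟩ := dif_pos h

theorem dRcoord_of_le {X : Type*} (T : X → X → X → X) {i k : ℕ} (x : ℕ → X) (h : k ≤ i) :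
    dRcoord T i x k = x k := by
  rw [dRcoord, dif_pos h]

theorem dRcoord_succ {X : Type*} (T : X → X → X → X) {i k : ℕ} (x : ℕ → X) (h : i ≤ k) :
    dRcoord T i x (k + 1) = T (dRcoord T i x k) (x (k + 1)) (x (k + 2)) := by
  rw [dRcoord, dif_neg (by omega), Nat.add_sub_cancel]

/-- In a ternary quasigroup both degeneracy conditions say that the middle entry `b` of some
consecutive triple `(a, b, c)` satisfies `abcT = b`. -/
theorem isDegenerate_iff {X : Type*} {T L R : X → X → X → X}
    (hTL : ∀ x y z : X, T (L x y z) y z = x) (hRT : ∀ x y z : X, R x y (T x y z) = z)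
    (hTR : ∀ x y z : X, T x y (R x y z) = z) (m : ℕ) (x : Fin (m + 2) → X) :
    IsDegenerate L R m x ↔ ∃ (j : ℕ) (h : j + 2 < m + 2),
      T (x ⟨j, by omega⟩) (x ⟨j + 1, by omega⟩) (x ⟨j + 2, h⟩) = x ⟨j + 1, by omega⟩ := by
  constructor
  · rintro ⟨j, h, a, b, ⟨h0, h1, h2⟩ | ⟨h0, h1, h2⟩⟩
    · exact ⟨j, h, by rw [h0, h1, h2, hTR]⟩
    · exact ⟨j, h, by rw [h0, h1, h2, hTL]⟩
  · rintro ⟨j, h, e⟩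
    refine ⟨j, h, x ⟨j, by omega⟩, x ⟨j + 1, by omega⟩, Or.inl ⟨rfl, rfl, ?_⟩⟩
    have := hRT (x ⟨j, by omega⟩) (x ⟨j + 1, by omega⟩) (x ⟨j + 2, h⟩)
    rw [e] at this
    exact this.symm

/-- The two right faces at a degenerate triple agree. -/
theorem dRcoord_eq_of_fixed {X : Type*} {T : X → X → X → X} {x : ℕ → X} {j : ℕ}
    (e : T (x j) (x (j + 1)) (x (j + 2)) = x (j + 1)) (k : ℕ) :
    dRcoord T j x k = dRcoord T (j + 1) x k := by
  induction k with
  | zero => rw [dRcoord_of_le T x (Nat.zero_le _), dRcoord_of_le T x (Nat.zero_le _)]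
  | succ k ih =>
    rcases lt_trichotomy k j with h | rfl | h
    · rw [dRcoord_of_le T x (by omega), dRcoord_of_le T x (by omega)]
    · rw [dRcoord_succ T x le_rfl, dRcoord_of_le T x le_rfl, dRcoord_of_le T x le_rfl, e]
    · rw [dRcoord_succ T x (by omega), dRcoord_succ T x (by omega), ih]

/-- A right face taken to the left of a degenerate triple moves the triple one step left. -/
theorem dRcoord_fixed_of_le {X : Type*} {T : X → X → X → X}
    (hA3R : ∀ a b c d : X, T a b (T b c d) = T a (T a b c) (T (T a b c) c d))
    {x : ℕ → X} {i j : ℕ} (hij : i ≤ j)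
    (e : T (x (j + 1)) (x (j + 2)) (x (j + 3)) = x (j + 2)) :
    T (dRcoord T i x j) (dRcoord T i x (j + 1)) (dRcoord T i x (j + 2)) =
      dRcoord T i x (j + 1) := by
  rw [dRcoord_succ T x (show i ≤ j + 1 by omega), dRcoord_succ T x hij, ← hA3R, e]

/-- for a KTQ `X` and every `n`, `∂_n^R(C_n^D(X)) ⊆ C_{n-1}^D(X)`
(the cases of nonpositive degree being trivial since there `C^D = 0`). -/
theorem boundaryR_maps_CD_into_CD {X : Type*} (T L M R : X → X → X → X)
    (hq1 : ∀ x1 x2 x3 : X, L (T x1 x2 x3) x2 x3 = x1)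
    (hq2 : ∀ x1 x2 x3 : X, T (L x1 x2 x3) x2 x3 = x1)
    (hq3 : ∀ x1 x2 x3 : X, M x1 (T x1 x2 x3) x3 = x2)
    (hq4 : ∀ x1 x2 x3 : X, T x1 (M x1 x2 x3) x3 = x2)
    (hq5 : ∀ x1 x2 x3 : X, R x1 x2 (T x1 x2 x3) = x3)
    (hq6 : ∀ x1 x2 x3 : X, T x1 x2 (R x1 x2 x3) = x3)
    (hA3L : ∀ a b c d : X, T (T a b c) c d = T (T a b (T b c d)) (T b c d) d)
    (hA3R : ∀ a b c d : X, T a b (T b c d) = T a (T a b c) (T (T a b c) c d)) :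
    ∀ n : ℕ, ∀ c ∈ CD L R (n + 1), boundaryR T (n + 1) c ∈ CD L R n := by
  intro n c hc
  have hdeg := isDegenerate_iff hq2 hq5 hq6
  induction hc using AddSubgroup.closure_induction with
  | zero => simp
  | add a b _ _ ha hb => rw [map_add]; exact add_mem ha hb
  | neg a _ ha => rw [map_neg]; exact neg_mem ha
  | mem c hc =>
    obtain ⟨x, hx, rfl⟩ := hc
    obtain ⟨j, hj, e⟩ := (hdeg _ x).1 hx
    rw [← ext_of_lt (n + 1) x, ← ext_of_lt (n + 1) x, ← ext_of_lt (n + 1) x] at e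
    have hface : ∀ i ∈ Finset.range (n + 2), i ≠ j ∧ i ≠ j + 1 →
        FreeAbelianGroup.of (dR T (n + 1) i x) ∈ CD L R n := by
      rintro i hi ⟨hij, hij'⟩
      rw [Finset.mem_range] at hi
      refine AddSubgroup.subset_closure ⟨_, (hdeg _ _).2 ?_, rfl⟩
      rcases lt_or_gt_of_ne hij with h | h
      · obtain ⟨j, rfl⟩ : ∃ l, j = l + 1 := ⟨j - 1, by omega⟩
        exact ⟨j, by omega, dRcoord_fixed_of_le hA3R (Nat.le_of_lt_succ h) e⟩
      · refine ⟨j, by omega, ?_⟩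
        simp only [dR]
        rwa [dRcoord_of_le T _ h.le, dRcoord_of_le T _ (show j + 1 ≤ i by omega),
          dRcoord_of_le T _ (show j + 2 ≤ i by omega)]
    have hpair : dR T (n + 1) j x = dR T (n + 1) (j + 1) x :=
      funext fun p => dRcoord_eq_of_fixed e p.1
    rw [boundaryR, FreeAbelianGroup.lift_apply_of,
      ← Finset.sum_erase_add _ _ (Finset.mem_range.2 (show j < n + 1 + 1 by omega)),
      ← Finset.sum_erase_add _ _ (Finset.mem_erase.2
        ⟨show j + 1 ≠ j by omega, Finset.mem_range.2 (show j + 1 < n + 1 + 1 by omega)⟩),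
      add_assoc _ (_ • _), hpair, ← add_smul, pow_succ, mul_neg_one, neg_add_cancel, zero_smul, add_zero]
    refine sum_mem fun i hi => zsmul_mem (hface i ?_ ?_) _
    · exact Finset.mem_of_mem_erase (Finset.mem_of_mem_erase hi)
    · exact ⟨Finset.ne_of_mem_erase (Finset.mem_of_mem_erase hi), Finset.ne_of_mem_erase hi⟩
end

section
/- For an involutory knot-theoretic ternary quasigroup (IKTQ) X and every n: ∂_n^L(C_n^I(X)) ⊆ C_{n-1}^I(X). -/
variable {X : Type*}

/-- `x[j]` for sequences, with `j = m + 1`. -/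
def seqSub (T : X → X → X → X) (x : ℕ → X) (m : ℕ) : ℕ → X :=
  Function.update x (m + 1) (T (x m) (x (m + 1)) (x (m + 2)))

section SeqSub

variable (T : X → X → X → X) (x : ℕ → X)

theorem dLcoord_of_lt {i k : ℕ} (h : i < k) : dLcoord T i x k = x k := by
  rw [dLcoord, dif_pos h]

theorem dLcoord_of_le {i k : ℕ} (h : k ≤ i) :
    dLcoord T i x k = T (x (k - 1)) (x k) (dLcoord T i x (k + 1)) := by
  rw [dLcoord, dif_neg (by omega)]

theorem seqSub_self (m : ℕ) : seqSub T x m (m + 1) = T (x m) (x (m + 1)) (x (m + 2)) := by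
  simp [seqSub]

theorem seqSub_of_ne {m k : ℕ} (h : k ≠ m + 1) : seqSub T x m k = x k := by
  simp [seqSub, h]

theorem seqSub_seqSub (hinv : ∀ a b c : X, T a (T a b c) c = b) (m : ℕ) :
    seqSub T (seqSub T x m) m = x := by
  funext k
  by_cases hk : k = m + 1
  · subst hk
    rw [seqSub_self, seqSub_self, seqSub_of_ne T x (by omega), seqSub_of_ne T x (by omega), hinv]
  · rw [seqSub_of_ne T _ hk, seqSub_of_ne T _ hk]

variable {T x}

/-- If two face coordinates agree at `l` and the sequences agree below `l`, then the face
coordinates agree below `l`. -/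
theorem dLcoord_eq_of_le {y : ℕ → X} {i i' l : ℕ} (hi : l ≤ i + 1) (hi' : l ≤ i' + 1)
    (hl : dLcoord T i x l = dLcoord T i' y l) (hxy : ∀ p < l, x p = y p) {k : ℕ} (hk : k ≤ l) :
    dLcoord T i x k = dLcoord T i' y k := by
  induction hk using Nat.decreasingInduction with
  | self => exact hl
  | of_succ k hk ih =>
    rw [dLcoord_of_le T x (by omega), dLcoord_of_le T y (by omega), ih,
      hxy _ (by omega), hxy _ hk]

/-- Face coordinates at `k` only depend on the entries from `k - 1` on. -/
theorem dLcoord_congr_ge {y : ℕ → X} {i l : ℕ} (hxy : ∀ p, l ≤ p → x p = y p)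
    {k : ℕ} (hk : l + 1 ≤ k) : dLcoord T i x k = dLcoord T i y k := by
  induction h : i + 1 - k generalizing k with
  | zero => rw [dLcoord_of_lt T x (by omega), dLcoord_of_lt T y (by omega), hxy _ (by omega)]
  | succ d ih =>
    rw [dLcoord_of_le T x (by omega), dLcoord_of_le T y (by omega), ih (by omega) (by omega),
      hxy _ (by omega), hxy k (by omega)]

variable (T x)

theorem dLcoord_seqSub_of_lt {i m : ℕ} (him : i < m) (k : ℕ) :
    dLcoord T i (seqSub T x m) k = if k = m + 1 then
      T (dLcoord T i x m) (dLcoord T i x (m + 1)) (dLcoord T i x (m + 2))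
      else dLcoord T i x k := by
  split_ifs with hk
  · subst hk
    rw [dLcoord_of_lt T _ (by omega), dLcoord_of_lt T _ him, dLcoord_of_lt T _ (by omega),
      dLcoord_of_lt T _ (by omega), seqSub_self]
  · rcases lt_or_ge i k with hik | hik
    · rw [dLcoord_of_lt T _ hik, dLcoord_of_lt T _ hik, seqSub_of_ne T x hk]
    · refine dLcoord_eq_of_le (l := i + 1) le_rfl le_rfl ?_
        (fun p hp => seqSub_of_ne T x (by omega)) (by omega)
      rw [dLcoord_of_lt T _ (by omega), dLcoord_of_lt T _ (by omega),
        seqSub_of_ne T x (by omega)]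

theorem dLcoord_seqSub_self (m k : ℕ) :
    dLcoord T m (seqSub T x m) k = dLcoord T (m + 1) x k := by
  rcases lt_or_ge (m + 1) k with hk | hk
  · rw [dLcoord_of_lt T _ (by omega), dLcoord_of_lt T _ hk, seqSub_of_ne T x (by omega)]
  · refine dLcoord_eq_of_le (l := m + 1) (by omega) (by omega) ?_
      (fun p hp => seqSub_of_ne T x (by omega)) hk
    rw [dLcoord_of_lt T _ (by omega), dLcoord_of_le T x le_rfl, dLcoord_of_lt T x (by omega),
      seqSub_self]
    rfl

theorem dLcoord_seqSub_of_gt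
    (hA3L : ∀ a b c d : X, T (T a b c) c d = T (T a b (T b c d)) (T b c d) d)
    (hA3R : ∀ a b c d : X, T a b (T b c d) = T a (T a b c) (T (T a b c) c d))
    {i m : ℕ} (him : m + 1 < i) (k : ℕ) :
    dLcoord T i (seqSub T x m) k = if k = m + 2 then
      T (dLcoord T i x (m + 1)) (dLcoord T i x (m + 2)) (dLcoord T i x (m + 3))
      else dLcoord T i x k := by
  have hge {p : ℕ} (hp : m + 3 ≤ p) : dLcoord T i (seqSub T x m) p = dLcoord T i x p :=
    dLcoord_congr_ge (l := m + 2) (fun q hq => seqSub_of_ne T x (by omega)) hp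
  have h2 : dLcoord T i x (m + 2) = T (x (m + 1)) (x (m + 2)) (dLcoord T i x (m + 3)) :=
    dLcoord_of_le T x (by omega)
  have h1 : dLcoord T i x (m + 1) = T (x m) (x (m + 1)) (dLcoord T i x (m + 2)) :=
    dLcoord_of_le T x (by omega)
  have h2' : dLcoord T i (seqSub T x m) (m + 2) =
      T (T (x m) (x (m + 1)) (x (m + 2))) (x (m + 2)) (dLcoord T i x (m + 3)) := by
    rw [dLcoord_of_le T _ (by omega), hge le_rfl, seqSub_of_ne T x (k := m + 2) (by omega)]
    exact congrArg (fun a => T a _ _) (seqSub_self T x m)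
  split_ifs with hk
  · rw [hk, h2', h1, h2, hA3L]
  · rcases lt_or_ge k (m + 2) with hkm | hkm
    · refine dLcoord_eq_of_le (l := m + 1) (by omega) (by omega) ?_
        (fun p hp => seqSub_of_ne T x (by omega)) (by omega)
      rw [dLcoord_of_le T _ (by omega), h2', seqSub_self, h1, h2, Nat.add_sub_cancel,
        seqSub_of_ne T x (by omega), ← hA3R]
    · exact hge (by omega)

end SeqSub

theorem ext_tupleSub (T : X → X → X → X) {n m : ℕ} (x : Fin (n + 2) → X) (hm : m + 1 ≤ n) :
    ext n (tupleSub T n x (m + 1) (by omega) hm) = seqSub T (ext n x) m := by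
  have hlt {p : ℕ} (hp : p < n + 2) : ext n x p = x ⟨p, hp⟩ := dif_pos hp
  funext k
  by_cases hk : k = m + 1
  · subst hk
    rw [seqSub_self, hlt (p := m) (by omega), hlt (p := m + 1) (by omega),
      hlt (p := m + 2) (by omega), ext, dif_pos (by omega), tupleSub, Function.update_self]
    rfl
  · rw [seqSub_of_ne T _ hk]
    unfold ext tupleSub
    split_ifs with h
    · exact Function.update_of_ne (by simpa [Fin.ext_iff] using hk) _ _
    · exact Function.update_of_ne (by simp [Fin.ext_iff]) _ _

/-- A tuple `y` whose coordinates are those of `d_i x` modified as in `x[j]` gives a generator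
of `C^I`. -/
theorem of_dL_add_of_mem_CI (T : X → X → X → X) {n i p : ℕ} (x y : Fin (n + 1 + 2) → X)
    (hp : p + 1 ≤ n)
    (h : ∀ k, dLcoord T i (ext (n + 1) y) k = if k = p + 2 then
      T (dLcoord T i (ext (n + 1) x) (p + 1)) (dLcoord T i (ext (n + 1) x) (p + 2))
        (dLcoord T i (ext (n + 1) x) (p + 3)) else dLcoord T i (ext (n + 1) x) k) :
    FreeAbelianGroup.of (dL T (n + 1) i x) + FreeAbelianGroup.of (dL T (n + 1) i y) ∈ CI T n := by
  refine AddSubgroup.subset_closure ⟨dL T (n + 1) i x, p + 1, by omega, hp, ?_⟩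
  congr 2
  funext q
  rw [dL, h]
  simp [tupleSub, Function.update_apply, Fin.ext_iff, dL]

/-- for an IKTQ `X` (a ternary quasigroup `(X,T,L,T,R)`, i.e.
with `T = M`, satisfying A3L and A3R) and every `n`,
`∂_n^L(C_n^I(X)) ⊆ C_{n-1}^I(X)` (the cases of nonpositive degree being
trivial since there `C^I = 0`). -/
theorem boundaryL_maps_CI_into_CI {X : Type*} (T L R : X → X → X → X)
    (hq1 : ∀ x1 x2 x3 : X, L (T x1 x2 x3) x2 x3 = x1)
    (hq2 : ∀ x1 x2 x3 : X, T (L x1 x2 x3) x2 x3 = x1)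
    (hinv : ∀ x1 x2 x3 : X, T x1 (T x1 x2 x3) x3 = x2)
    (hq5 : ∀ x1 x2 x3 : X, R x1 x2 (T x1 x2 x3) = x3)
    (hq6 : ∀ x1 x2 x3 : X, T x1 x2 (R x1 x2 x3) = x3)
    (hA3L : ∀ a b c d : X, T (T a b c) c d = T (T a b (T b c d)) (T b c d) d)
    (hA3R : ∀ a b c d : X, T a b (T b c d) = T a (T a b c) (T (T a b c) c d)) :
    ∀ n : ℕ, ∀ c ∈ CI T (n + 1), boundaryL T (n + 1) c ∈ CI T n := by
  intro n c hc
  rw [CI] at hc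
  induction hc using AddSubgroup.closure_induction with
  | zero => rw [map_zero]; exact zero_mem _
  | add a b _ _ ha hb => rw [map_add]; exact add_mem ha hb
  | neg a _ ha => rw [map_neg]; exact neg_mem ha
  | mem c hc =>
    obtain ⟨x, j, h1, h2, rfl⟩ := hc
    obtain ⟨m, rfl⟩ : ∃ m, j = m + 1 := ⟨j - 1, by omega⟩
    set y := tupleSub T (n + 1) x (m + 1) h1 h2
    have hy : ext (n + 1) y = seqSub T (ext (n + 1) x) m := ext_tupleSub T x h2
    have hx : ext (n + 1) x = seqSub T (ext (n + 1) y) m := by rw [hy, seqSub_seqSub T _ hinv]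
    have hface (i : ℕ) (hi : i < n + 2) (him : i ≠ m) (him' : i ≠ m + 1) :
        FreeAbelianGroup.of (dL T (n + 1) i x) + FreeAbelianGroup.of (dL T (n + 1) i y) ∈
          CI T n := by
      rcases lt_or_ge i m with h | h
      · obtain ⟨p, rfl⟩ : ∃ p, m = p + 1 := ⟨m - 1, by omega⟩
        refine of_dL_add_of_mem_CI T (p := p) x y (by omega) fun k => ?_
        rw [hy, dLcoord_seqSub_of_lt T _ h]
      · refine of_dL_add_of_mem_CI T (p := m) x y (by omega) fun k => ?_
        rw [hy, dLcoord_seqSub_of_gt T _ hA3L hA3R (by omega)]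
    have hmy : dL T (n + 1) m y = dL T (n + 1) (m + 1) x := by
      funext q
      rw [dL, dL, hy, dLcoord_seqSub_self]
    have hmx : dL T (n + 1) m x = dL T (n + 1) (m + 1) y := by
      funext q
      rw [dL, dL, hx, dLcoord_seqSub_self]
    rw [map_add, boundaryL, FreeAbelianGroup.lift_apply_of, FreeAbelianGroup.lift_apply_of,
      ← Finset.sum_add_distrib]
    have hpair : ({m, m + 1} : Finset ℕ) ⊆ Finset.range (n + 1 + 1) := by
      intro i hi
      simp only [Finset.mem_insert, Finset.mem_singleton] at hi
      rw [Finset.mem_range]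
      omega
    rw [← Finset.sum_sdiff hpair, Finset.sum_pair (by omega), hmy, hmx, pow_succ]
    refine add_mem (sum_mem fun i hi => ?_) ?_
    · simp only [Finset.mem_sdiff, Finset.mem_range, Finset.mem_insert, Finset.mem_singleton,
        not_or] at hi
      rw [← smul_add]
      exact zsmul_mem (hface i hi.1 hi.2.1 hi.2.2) _
    · convert zero_mem (CI T n) using 1
      module
end
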